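/- Let μ be a non-atomic self-similar measure on ℝ with respect to a self-similar IFS {φ_i(x) = s_i·x + t_i}_{i=1}^n and a strictly positive probability vector, and let β > 1. Then there exists a model Σ = ((Φ^{(i)})_{i∈I}, (p_i)_{i∈I}, ℙ) such that: (a) ℙ is a Bernoulli (product) measure on Ω = I^ℕ; (b) the model satisfies the strong separation condition; (c) η^{(ω)} is non-atomic for ℙ-almost every ω; (d) μ = ∫ η^{(ω)} dℙ(ω), i.e. μ(E) = ∫ η^{(ω)}(E) dℙ(ω) for every Borel set E ⊆ ℝ; and (e) if log|s_j| / log β is irrational for some j ∈ {1,…,n}, then there exists i ∈ I such that log|r_i| / log β is irrational. -/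

import Mathlib

open MeasureTheory Filter Topology

noncomputable section

/-- The left shift on sequences. -/
def shiftSeq {I : Type*} (ω : ℕ → I) : ℕ → I := fun n => ω (n + 1)

/-- The coding map `Π_ω(u) = Σ_{n} (Π_{j<n} r_{ω_j}) · t^{(ω_n)}_{u_n}` of a model. -/
def coding {I : Type*} (k : I → ℕ) (r : I → ℝ) (t : (i : I) → Fin (k i) → ℝ)
    (ω : ℕ → I) (u : (n : ℕ) → Fin (k (ω n))) : ℝ :=
  ∑' n : ℕ, (∏ j ∈ Finset.range n, r (ω j)) * t (ω n) (u n)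

/-- The set `Y^{(ω)}`, the image of the coding map. -/
def Yset {I : Type*} (k : I → ℕ) (r : I → ℝ) (t : (i : I) → Fin (k i) → ℝ)
    (ω : ℕ → I) : Set ℝ :=
  Set.range (coding k r t ω)

/-- `μ` is stationary for the affine maps `x ↦ s i * x + a i` with weights `p`. -/
def SelfSimilar {ι : Type*} [Fintype ι] (p s a : ι → ℝ) (μ : Measure ℝ) : Prop :=
  μ = ∑ i, ENNReal.ofReal (p i) • Measure.map (fun x => s i * x + a i) μ

namespace SelfSimilar

variable {ι κ : Type*} [Fintype ι] [Fintype κ] {p s a : ι → ℝ} {μ ν : Measure ℝ}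

theorem measure_eq_sum (h : SelfSimilar p s a μ) {E : Set ℝ} (hE : MeasurableSet E) :
    μ E = ∑ i, ENNReal.ofReal (p i) * μ ((fun x => s i * x + a i) ⁻¹' E) := by
  conv_lhs => rw [h]
  simp only [Measure.coe_finsetSum, Finset.sum_apply, Measure.smul_apply, smul_eq_mul]
  refine Finset.sum_congr rfl fun i _ => ?_
  rw [Measure.map_apply (by fun_prop) hE]

theorem of_measure_eq_sum
    (h : ∀ E, MeasurableSet E →
      μ E = ∑ i, ENNReal.ofReal (p i) * μ ((fun x => s i * x + a i) ⁻¹' E)) :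
    SelfSimilar p s a μ := by
  refine Measure.ext fun E hE => ?_
  rw [h E hE]
  simp only [Measure.coe_finsetSum, Finset.sum_apply, Measure.smul_apply, smul_eq_mul]
  refine Finset.sum_congr rfl fun i _ => ?_
  rw [Measure.map_apply (by fun_prop) hE]

theorem reindex (e : κ ≃ ι) (h : SelfSimilar p s a μ) :
    SelfSimilar (p ∘ e) (s ∘ e) (a ∘ e) μ :=
  of_measure_eq_sum fun E hE => by
    rw [h.measure_eq_sum hE, ← e.sum_comp]; rfl

theorem prod {p' s' a' : κ → ℝ} (hp : ∀ i, 0 ≤ p i)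
    (h : SelfSimilar p s a μ) (h' : SelfSimilar p' s' a' μ) :
    SelfSimilar (fun x : ι × κ => p x.1 * p' x.2) (fun x => s x.1 * s' x.2)
      (fun x => s x.1 * a' x.2 + a x.1) μ := by
  refine of_measure_eq_sum fun E hE => ?_
  rw [h.measure_eq_sum hE, Fintype.sum_prod_type]
  refine Finset.sum_congr rfl fun i _ => ?_
  have hf : Measurable fun x : ℝ => s i * x + a i := by fun_prop
  rw [h'.measure_eq_sum (hf hE), Finset.mul_sum]
  refine Finset.sum_congr rfl fun j _ => ?_
  rw [ENNReal.ofReal_mul (hp i), mul_assoc, ← Set.preimage_comp]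
  congr 3
  ext x
  simp only [Function.comp_apply, Set.mem_preimage]
  ring_nf

theorem charFun_eq [IsProbabilityMeasure μ] (hp : ∀ i, 0 ≤ p i) (h : SelfSimilar p s a μ)
    (ξ : ℝ) :
    charFun μ ξ =
      ∑ i, (p i : ℂ) * (charFun μ (s i * ξ) * Complex.exp (↑(a i * ξ) * Complex.I)) := by
  have hmap (i : ι) : charFun (Measure.map (fun x => s i * x + a i) μ) ξ
      = charFun μ (s i * ξ) * Complex.exp (↑(a i * ξ) * Complex.I) := by
    have : (fun x => s i * x + a i) = (fun x => x + a i) ∘ (fun x => s i * x) := rfl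
    rw [this, ← Measure.map_map (by fun_prop) (by fun_prop), charFun_map_add_const,
      charFun_map_mul]
    simp [mul_comm]
  conv_lhs => rw [h]
  rw [charFun_apply_real, integral_finsetSum_measure]
  · refine Finset.sum_congr rfl fun i _ => ?_
    rw [integral_smul_measure, ← charFun_apply_real, hmap, ENNReal.toReal_ofReal (hp i)]
    simp
  · intro i _
    have : IsProbabilityMeasure (Measure.map (fun x => s i * x + a i) μ) :=
      Measure.isProbabilityMeasure_map (by fun_prop)
    have hfin : IsFiniteMeasure (ENNReal.ofReal (p i) • Measure.map (fun x => s i * x + a i) μ) :=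
      ⟨by simp⟩
    refine Integrable.of_bound (C := 1) (by fun_prop) (ae_of_all _ fun x => ?_)
    rw [← Complex.ofReal_mul, Complex.norm_exp_ofReal_mul_I]

/-- A contracting affine system has at most one stationary probability measure. -/
theorem unique [IsProbabilityMeasure μ] [IsProbabilityMeasure ν] (hp : ∀ i, 0 ≤ p i)
    (hsum : ∑ i, p i = 1) {c : ℝ} (hc : c < 1) (hs : ∀ i, |s i| ≤ c)
    (hμ : SelfSimilar p s a μ) (hν : SelfSimilar p s a ν) : μ = ν := by
  have hne : Nonempty ι := by
    by_contra hne
    rw [not_nonempty_iff] at hne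
    simp at hsum
  have hc0 : 0 ≤ c := (abs_nonneg _).trans (hs hne.some)
  refine Measure.ext_of_charFun (funext fun ξ => ?_)
  set D : ℝ → ℂ := fun ξ => charFun μ ξ - charFun ν ξ with hD
  have hD0 : D 0 = 0 := by simp [hD]
  have hcont : Continuous D := continuous_charFun.sub continuous_charFun
  have hstep (ξ : ℝ) : ‖D ξ‖ ≤ ∑ i, p i * ‖D (s i * ξ)‖ := by
    have : D ξ = ∑ i, (p i : ℂ) * (D (s i * ξ) * Complex.exp (↑(a i * ξ) * Complex.I)) := by
      simp only [hD]
      rw [hμ.charFun_eq hp, hν.charFun_eq hp, ← Finset.sum_sub_distrib]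
      exact Finset.sum_congr rfl fun i _ => by ring
    rw [this]
    refine (norm_sum_le _ _).trans (Finset.sum_le_sum fun i _ => le_of_eq ?_)
    rw [norm_mul, norm_mul, Complex.norm_exp_ofReal_mul_I, mul_one, Complex.norm_real,
      Real.norm_of_nonneg (hp i)]
  rw [← sub_eq_zero, ← norm_le_zero_iff]
  refine le_of_forall_pos_le_add fun ε hε => ?_
  rw [zero_add]
  obtain ⟨δ, hδ, hδε⟩ := Metric.continuous_iff.1 hcont 0 ε hε
  have hiter (m : ℕ) : ∀ ξ : ℝ, c ^ m * |ξ| < δ → ‖D ξ‖ ≤ ε := by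
    induction m with
    | zero =>
      intro ξ hξ
      have := hδε ξ (by simpa using hξ)
      rw [hD0, dist_zero_right] at this
      exact this.le
    | succ m ih =>
      intro ξ hξ
      calc ‖D ξ‖ ≤ ∑ i, p i * ‖D (s i * ξ)‖ := hstep ξ
        _ ≤ ∑ i, p i * ε := by
          refine Finset.sum_le_sum fun i _ => mul_le_mul_of_nonneg_left (ih _ ?_) (hp i)
          refine lt_of_le_of_lt ?_ hξ
          rw [abs_mul, pow_succ, mul_assoc]
          gcongr
          exact hs i
        _ = ε := by rw [← Finset.sum_mul, hsum, one_mul]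
  have hlim : Tendsto (fun m : ℕ => c ^ m * |ξ|) atTop (𝓝 (0 * |ξ|)) :=
    (tendsto_pow_atTop_nhds_zero_of_lt_one hc0 hc).mul_const _
  rw [zero_mul] at hlim
  obtain ⟨m, hm⟩ := (hlim.eventually (gt_mem_nhds hδ)).exists
  exact hiter m ξ hm

/-- A stationary measure of contractions with a common fixed point is the Dirac mass there. -/
theorem eq_dirac_of_fixedPoint [IsProbabilityMeasure μ] (hp : ∀ i, 0 ≤ p i)
    (hsum : ∑ i, p i = 1) {c : ℝ} (hc : c < 1) (hs : ∀ i, |s i| ≤ c)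
    (hμ : SelfSimilar p s a μ) {x : ℝ} (hx : ∀ i, s i * x + a i = x) :
    μ = Measure.dirac x := by
  refine hμ.unique hp hsum hc hs (of_measure_eq_sum fun E hE => ?_)
  have (i : ι) : Measure.dirac x ((fun x => s i * x + a i) ⁻¹' E) = Measure.dirac x E := by
    have hf : Measurable fun x : ℝ => s i * x + a i := by fun_prop
    rw [← Measure.map_apply hf hE, Measure.map_dirac, hx]
  simp_rw [this]
  rw [← Finset.sum_mul, ← ENNReal.ofReal_sum_of_nonneg fun i _ => hp i, hsum]
  simp

end SelfSimilar

/-- The measure on a finite type with prescribed point masses. -/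
def weightMeasure {α : Type*} [Fintype α] [MeasurableSpace α] (p : α → ℝ) : Measure α :=
  ∑ i, ENNReal.ofReal (p i) • Measure.dirac i

section SequenceMeasures

variable {α : Type*} [MeasurableSpace α]

theorem weightMeasure_singleton [Fintype α] [DiscreteMeasurableSpace α] (p : α → ℝ) (i : α) :
    weightMeasure p {i} = ENNReal.ofReal (p i) := by
  classical
  simp only [weightMeasure, Measure.coe_finsetSum, Finset.sum_apply, Measure.smul_apply,
    smul_eq_mul]
  rw [Finset.sum_eq_single i]
  · simp
  · intro j _ hj
    rw [Measure.dirac_apply' _ (MeasurableSet.of_discrete)]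
    simp [hj]
  · simp

theorem isProbabilityMeasure_weightMeasure [Fintype α] {p : α → ℝ} (hp : ∀ i, 0 ≤ p i)
    (hsum : ∑ i, p i = 1) : IsProbabilityMeasure (weightMeasure p) := by
  constructor
  simp only [weightMeasure, Measure.coe_finsetSum, Finset.sum_apply, Measure.smul_apply,
    smul_eq_mul, measure_univ, mul_one]
  rw [← ENNReal.ofReal_sum_of_nonneg fun i _ => hp i, hsum, ENNReal.ofReal_one]

theorem infinitePi_initial_segment {X : ℕ → Type*} [∀ j, MeasurableSpace (X j)]
    [∀ j, DiscreteMeasurableSpace (X j)] (m : (j : ℕ) → Measure (X j))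
    [∀ j, IsProbabilityMeasure (m j)] (N : ℕ) (c : (j : ℕ) → X j) :
    Measure.infinitePi m {u | ∀ j < N, u j = c j} = ∏ j ∈ Finset.range N, m j {c j} := by
  rw [← Measure.infinitePi_pi m (s := Finset.range N) (t := fun j => {c j})
    fun _ _ => MeasurableSet.of_discrete]
  congr 1
  ext u
  simp

theorem pi_eq_generateFrom_cylinders [Finite α] [DiscreteMeasurableSpace α] :
    (MeasurableSpace.pi : MeasurableSpace (ℕ → α)) =
      MeasurableSpace.generateFrom
        {S : Set (ℕ → α) | ∃ c : ℕ → α, ∃ N : ℕ, S = {w | ∀ j < N, w j = c j}} := by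
  let _ : TopologicalSpace α := ⊥
  have : DiscreteTopology α := ⟨rfl⟩
  have : BorelSpace α := ⟨by
    rw [borel_eq_top_of_discrete]
    exact top_unique fun _ _ => MeasurableSet.of_discrete⟩
  rw [(inferInstance : BorelSpace (ℕ → α)).measurable_eq]
  exact (PiNat.isTopologicalBasis_cylinders fun _ : ℕ => α).borel_eq_generateFrom

theorem isPiSystem_cylinders {α : Type*} :
    IsPiSystem {S : Set (ℕ → α) | ∃ c : ℕ → α, ∃ N : ℕ, S = {w | ∀ j < N, w j = c j}} := by
  rintro _ ⟨c, N, rfl⟩ _ ⟨d, M, rfl⟩ ⟨x, hx, hx'⟩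
  refine ⟨x, max N M, ?_⟩
  ext w
  simp only [Set.mem_inter_iff, Set.mem_ofPred_eq, lt_sup_iff] at hx hx' ⊢
  constructor
  · rintro ⟨h, h'⟩ j (hj | hj)
    · rw [h j hj, hx j hj]
    · rw [h' j hj, hx' j hj]
  · exact fun h => ⟨fun j hj => by rw [h j (Or.inl hj), hx j hj],
      fun j hj => by rw [h j (Or.inr hj), hx' j hj]⟩

theorem measure_ext_cylinders [Finite α] [DiscreteMeasurableSpace α] {μ ν : Measure (ℕ → α)}
    [IsProbabilityMeasure μ] [IsProbabilityMeasure ν]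
    (h : ∀ (c : ℕ → α) (N : ℕ), μ {w | ∀ j < N, w j = c j} = ν {w | ∀ j < N, w j = c j}) :
    μ = ν := by
  refine ext_of_generate_finite _ pi_eq_generateFrom_cylinders isPiSystem_cylinders ?_ (by simp)
  rintro _ ⟨c, N, rfl⟩
  exact h c N

/-- Prepend a letter to a sequence. -/
def consSeq {α : Type*} (x : α) (w : ℕ → α) : ℕ → α
  | 0 => x
  | n + 1 => w n

theorem measurable_consSeq (x : α) : Measurable (consSeq x) := by
  refine measurable_pi_iff.2 fun n => ?_
  cases n with
  | zero => exact measurable_const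
  | succ n => exact measurable_pi_apply n

theorem infinitePi_eq_sum_map_consSeq [Fintype α] [DiscreteMeasurableSpace α]
    {p : α → ℝ} (hp : ∀ i, 0 ≤ p i)
    (hsum : ∑ i, p i = 1) :
    Measure.infinitePi (fun _ : ℕ => weightMeasure p) =
      ∑ i, ENNReal.ofReal (p i) •
        (Measure.infinitePi fun _ : ℕ => weightMeasure p).map (consSeq i) := by
  have := isProbabilityMeasure_weightMeasure hp hsum
  have hcons (i : α) : IsProbabilityMeasure
      ((Measure.infinitePi fun _ : ℕ => weightMeasure p).map (consSeq i)) :=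
    Measure.isProbabilityMeasure_map (measurable_consSeq i).aemeasurable
  have : IsProbabilityMeasure (∑ i, ENNReal.ofReal (p i) •
        (Measure.infinitePi fun _ : ℕ => weightMeasure p).map (consSeq i)) := by
    constructor
    simp only [Measure.coe_finsetSum, Finset.sum_apply, Measure.smul_apply,
      smul_eq_mul, measure_univ, mul_one]
    rw [← ENNReal.ofReal_sum_of_nonneg fun i _ => hp i, hsum, ENNReal.ofReal_one]
  refine measure_ext_cylinders fun c N => ?_
  cases N with
  | zero => simp only [not_lt_zero, false_imp_iff, implies_true, Set.ofPred_true, measure_univ]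
  | succ N =>
    have hmeas : MeasurableSet {w : ℕ → α | ∀ j < N + 1, w j = c j} := by
      rw [pi_eq_generateFrom_cylinders]
      exact MeasurableSpace.measurableSet_generateFrom ⟨c, N + 1, rfl⟩
    have hpre (i : α) : consSeq i ⁻¹' {w : ℕ → α | ∀ j < N + 1, w j = c j} =
        {w | i = c 0 ∧ ∀ j < N, w j = c (j + 1)} := by
      ext w
      simp only [Set.mem_preimage, Set.mem_ofPred_eq, Nat.forall_lt_succ_left']
      rfl
    simp only [Measure.coe_finsetSum, Finset.sum_apply, Measure.smul_apply, smul_eq_mul]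
    rw [infinitePi_initial_segment, Finset.sum_eq_single (c 0)]
    · rw [Measure.map_apply (measurable_consSeq _) hmeas, hpre]
      simp only [true_and]
      rw [infinitePi_initial_segment _ N fun j => c (j + 1), Finset.prod_range_succ',
        weightMeasure_singleton, mul_comm]
    · intro i _ hi
      rw [Measure.map_apply (measurable_consSeq _) hmeas, hpre]
      simp [hi]
    · simp

theorem selfSimilar_map_infinitePi [Fintype α] [DiscreteMeasurableSpace α]
    {p s a : α → ℝ} (hp : ∀ i, 0 ≤ p i)
    (hsum : ∑ i, p i = 1) {f : (ℕ → α) → ℝ} (hf : Measurable f)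
    (hcons : ∀ i w, f (consSeq i w) = s i * f w + a i) :
    SelfSimilar p s a ((Measure.infinitePi fun _ : ℕ => weightMeasure p).map f) := by
  refine SelfSimilar.of_measure_eq_sum fun E hE => ?_
  rw [Measure.map_apply hf hE]
  conv_lhs => rw [infinitePi_eq_sum_map_consSeq hp hsum]
  simp only [Measure.coe_finsetSum, Finset.sum_apply, Measure.smul_apply, smul_eq_mul]
  refine Finset.sum_congr rfl fun i _ => ?_
  have hφ : Measurable fun x : ℝ => s i * x + a i := by fun_prop
  rw [Measure.map_apply (measurable_consSeq i) (hf hE), Measure.map_apply hf (hφ hE)]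
  congr 2
  ext w
  simp [hcons]

end SequenceMeasures

section Coding

variable {I : Type*} {k : I → ℕ} {r : I → ℝ} {t : (i : I) → Fin (k i) → ℝ} {c R : ℝ}

theorem abs_prod_le_pow (hr : ∀ i, |r i| ≤ c) (ω : ℕ → I) (n : ℕ) :
    |∏ j ∈ Finset.range n, r (ω j)| ≤ c ^ n := by
  rw [Finset.abs_prod]
  exact (Finset.prod_le_prod (fun _ _ => abs_nonneg _) fun j _ => hr (ω j)).trans_eq (by simp)

theorem summable_coding (hc : c < 1) (hr : ∀ i, |r i| ≤ c) (hR : 0 ≤ R)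
    (ht : ∀ i u, |t i u| ≤ R * (1 - |r i|)) (ω : ℕ → I) (u : (n : ℕ) → Fin (k (ω n))) :
    Summable fun n : ℕ => (∏ j ∈ Finset.range n, r (ω j)) * t (ω n) (u n) := by
  have hc0 : 0 ≤ c := (abs_nonneg _).trans (hr (ω 0))
  refine Summable.of_norm_bounded ((summable_geometric_of_lt_one hc0 hc).mul_right R) fun n => ?_
  rw [Real.norm_eq_abs, abs_mul]
  gcongr
  · exact abs_prod_le_pow hr ω n
  · exact (ht _ _).trans (mul_le_of_le_one_right hR (by linarith [abs_nonneg (r (ω n))]))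

theorem coding_eq_head_add (hc : c < 1) (hr : ∀ i, |r i| ≤ c) (hR : 0 ≤ R)
    (ht : ∀ i u, |t i u| ≤ R * (1 - |r i|)) (ω : ℕ → I) (u : (n : ℕ) → Fin (k (ω n))) :
    coding k r t ω u =
      r (ω 0) * coding k r t (shiftSeq ω) (fun n => u (n + 1)) + t (ω 0) (u 0) := by
  unfold coding
  rw [(summable_coding hc hr hR ht ω u).tsum_eq_zero_add, ← tsum_mul_left, add_comm]
  congr 1
  · refine tsum_congr fun n => ?_
    rw [Finset.prod_range_succ', mul_comm _ (r (ω 0)), mul_assoc]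
    rfl
  · simp

theorem abs_coding_le (hc : c < 1) (hr : ∀ i, |r i| ≤ c) (hR : 0 ≤ R)
    (ht : ∀ i u, |t i u| ≤ R * (1 - |r i|)) (ω : ℕ → I) (u : (n : ℕ) → Fin (k (ω n))) :
    |coding k r t ω u| ≤ R := by
  have hpartial (N : ℕ) :
      |∑ n ∈ Finset.range N, (∏ j ∈ Finset.range n, r (ω j)) * t (ω n) (u n)| ≤
        R * (1 - |∏ j ∈ Finset.range N, r (ω j)|) := by
    induction N with
    | zero => simp
    | succ N ih =>
      rw [Finset.sum_range_succ, Finset.prod_range_succ, abs_mul]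
      have h1 := abs_add_le
        (∑ n ∈ Finset.range N, (∏ j ∈ Finset.range n, r (ω j)) * t (ω n) (u n))
        ((∏ j ∈ Finset.range N, r (ω j)) * t (ω N) (u N))
      rw [abs_mul] at h1
      have h2 := mul_le_mul_of_nonneg_left (ht (ω N) (u N))
        (abs_nonneg (∏ j ∈ Finset.range N, r (ω j)))
      linarith
  refine le_of_tendsto (summable_coding hc hr hR ht ω u).hasSum.tendsto_sum_nat.abs
    (Eventually.of_forall fun N => (hpartial N).trans ?_)
  exact mul_le_of_le_one_right hR (by linarith [abs_nonneg (∏ j ∈ Finset.range N, r (ω j))])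

theorem coding_injective (hc : c < 1) (hr : ∀ i, |r i| ≤ c) (hR : 0 ≤ R)
    (ht : ∀ i u, |t i u| ≤ R * (1 - |r i|)) (hr0 : ∀ i, r i ≠ 0)
    (hsep : ∀ i u v, u ≠ v → ∀ x y, |x| ≤ R → |y| ≤ R → r i * x + t i u ≠ r i * y + t i v)
    (ω : ℕ → I) : Function.Injective (coding k r t ω) := by
  have hstep (ω : ℕ → I) (u v : (n : ℕ) → Fin (k (ω n)))
      (h : coding k r t ω u = coding k r t ω v) :
      u 0 = v 0 ∧ coding k r t (shiftSeq ω) (fun n => u (n + 1)) =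
        coding k r t (shiftSeq ω) (fun n => v (n + 1)) := by
    rw [coding_eq_head_add hc hr hR ht, coding_eq_head_add hc hr hR ht ω v] at h
    have h0 : u 0 = v 0 := by
      by_contra hne
      exact hsep (ω 0) (u 0) (v 0) hne _ _ (abs_coding_le hc hr hR ht _ _)
        (abs_coding_le hc hr hR ht _ _) h
    refine ⟨h0, ?_⟩
    rw [h0] at h
    exact mul_left_cancel₀ (hr0 (ω 0)) (add_right_cancel h)
  have hall (n : ℕ) : ∀ (ω : ℕ → I) (u v : (n : ℕ) → Fin (k (ω n))),
      coding k r t ω u = coding k r t ω v → u n = v n := by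
    induction n with
    | zero => exact fun ω u v h => (hstep ω u v h).1
    | succ n ih =>
      exact fun ω u v h => ih (shiftSeq ω) (fun n => u (n + 1)) (fun n => v (n + 1))
        (hstep ω u v h).2
  exact fun u v h => funext fun n => hall n ω u v h

theorem disjoint_image_Yset (hc : c < 1) (hr : ∀ i, |r i| ≤ c) (hR : 0 ≤ R)
    (ht : ∀ i u, |t i u| ≤ R * (1 - |r i|))
    (hsep : ∀ i u v, u ≠ v → ∀ x y, |x| ≤ R → |y| ≤ R → r i * x + t i u ≠ r i * y + t i v)
    (ω : ℕ → I) (i : I) {u v : Fin (k i)} (huv : u ≠ v) :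
    Disjoint ((fun x => r i * x + t i u) '' Yset k r t ω)
      ((fun x => r i * x + t i v) '' Yset k r t ω) := by
  rw [Set.disjoint_left]
  rintro _ ⟨_, ⟨w, rfl⟩, rfl⟩ ⟨_, ⟨w', rfl⟩, h⟩
  exact hsep i u v huv _ _ (abs_coding_le hc hr hR ht _ _) (abs_coding_le hc hr hR ht _ _) h.symm

/-- A disjoint union of discrete measurable spaces is discrete. -/
instance discreteMeasurableSpace_sigma {ι : Type*} {α : ι → Type*} [∀ i, MeasurableSpace (α i)]
    [∀ i, DiscreteMeasurableSpace (α i)] : DiscreteMeasurableSpace (Σ i, α i) :=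
  ⟨fun s => MeasurableSpace.measurableSet_iInf.2 fun i =>
    MeasurableSet.of_discrete (s := Set.preimage (Sigma.mk i) s)⟩

/-- The coding map on sequences of pairs. -/
def sigmaCoding (k : I → ℕ) (r : I → ℝ) (t : (i : I) → Fin (k i) → ℝ)
    (w : ℕ → Σ i, Fin (k i)) : ℝ :=
  coding k r t (fun n => (w n).1) fun n => (w n).2

theorem sigmaCoding_consSeq (hc : c < 1) (hr : ∀ i, |r i| ≤ c) (hR : 0 ≤ R)
    (ht : ∀ i u, |t i u| ≤ R * (1 - |r i|)) (x : Σ i, Fin (k i)) (w : ℕ → Σ i, Fin (k i)) :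
    sigmaCoding k r t (consSeq x w) = r x.1 * sigmaCoding k r t w + t x.1 x.2 :=
  coding_eq_head_add hc hr hR ht _ _

theorem measurable_sigmaCoding (hc : c < 1) (hr : ∀ i, |r i| ≤ c) (hR : 0 ≤ R)
    (ht : ∀ i u, |t i u| ≤ R * (1 - |r i|)) : Measurable (sigmaCoding k r t) := by
  have hlim (w : ℕ → Σ i, Fin (k i)) : Tendsto (fun N => ∑ n ∈ Finset.range N,
      (∏ j ∈ Finset.range n, r (w j).1) * t (w n).1 (w n).2) atTop (𝓝 (sigmaCoding k r t w)) :=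
    (summable_coding hc hr hR ht (fun n => (w n).1) fun n => (w n).2).hasSum.tendsto_sum_nat
  refine measurable_of_tendsto_metrizable (fun N => ?_) (tendsto_pi_nhds.2 hlim)
  have hr' (j : ℕ) : Measurable fun w : ℕ → Σ i, Fin (k i) => r (w j).1 :=
    (Measurable.of_discrete (f := fun x : Σ i, Fin (k i) => r x.1)).comp (measurable_pi_apply j)
  have htn (n : ℕ) : Measurable fun w : ℕ → Σ i, Fin (k i) => t (w n).1 (w n).2 :=
    (Measurable.of_discrete (f := fun x : Σ i, Fin (k i) => t x.1 x.2)).comp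
      (measurable_pi_apply n)
  exact Finset.measurable_sum _ fun n _ =>
    (Finset.measurable_prod _ fun j _ => hr' j).mul (htn n)

/-- Attach the letters of `ω` to a sequence in the corresponding fibres. -/
def pairSeq (ω : ℕ → I) (u : (n : ℕ) → Fin (k (ω n))) : ℕ → Σ i, Fin (k i) :=
  fun n => ⟨ω n, u n⟩

theorem measurable_pairSeq (ω : ℕ → I) :
    Measurable (pairSeq (k := k) ω) :=
  measurable_pi_iff.2 fun n =>
    (Measurable.of_discrete (f := fun x : Fin (k (ω n)) => (⟨ω n, x⟩ : Σ i, Fin (k i)))).comp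
      (measurable_pi_apply n)

theorem measurable_coding (hc : c < 1) (hr : ∀ i, |r i| ≤ c) (hR : 0 ≤ R)
    (ht : ∀ i u, |t i u| ≤ R * (1 - |r i|)) (ω : ℕ → I) : Measurable (coding k r t ω) :=
  (measurable_sigmaCoding hc hr hR ht).comp (measurable_pairSeq ω)

end Coding

section Disintegration

variable {I : Type*} [Fintype I]
  {k : I → ℕ} {q : I → ℝ} {pm : (i : I) → Fin (k i) → ℝ}

/-- The Bernoulli measure on sequences with marginal `q`. -/
def bernoulliMeasure {α : Type*} [Fintype α] [MeasurableSpace α] (q : α → ℝ) : Measure (ℕ → α) :=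
  Measure.infinitePi fun _ => weightMeasure q

/-- The product measure over the fibres along `ω`. -/
def fiberMeasure {I : Type*} {k : I → ℕ} (pm : (i : I) → Fin (k i) → ℝ) (ω : ℕ → I) :
    Measure ((j : ℕ) → Fin (k (ω j))) :=
  Measure.infinitePi fun j => weightMeasure (pm (ω j))

theorem isProbabilityMeasure_bernoulliMeasure {α : Type*} [Fintype α] [MeasurableSpace α]
    {q : α → ℝ} (hq : ∀ i, 0 ≤ q i) (hqsum : ∑ i, q i = 1) :
    IsProbabilityMeasure (bernoulliMeasure q) := by
  have := isProbabilityMeasure_weightMeasure hq hqsum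
  unfold bernoulliMeasure
  infer_instance

theorem isProbabilityMeasure_fiberMeasure {I : Type*} {k : I → ℕ} {pm : (i : I) → Fin (k i) → ℝ}
    (hpm : ∀ i u, 0 ≤ pm i u) (hpmsum : ∀ i, ∑ u, pm i u = 1) (ω : ℕ → I) :
    IsProbabilityMeasure (fiberMeasure pm ω) := by
  have (i : I) := isProbabilityMeasure_weightMeasure (hpm i) (hpmsum i)
  unfold fiberMeasure
  infer_instance

theorem bernoulliMeasure_cylinder {α : Type*} [Fintype α] [MeasurableSpace α]
    [DiscreteMeasurableSpace α] {q : α → ℝ} (hq : ∀ i, 0 ≤ q i) (hqsum : ∑ i, q i = 1)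
    (N : ℕ) (c : ℕ → α) :
    bernoulliMeasure q {ω | ∀ j < N, ω j = c j} =
      ∏ j ∈ Finset.range N, ENNReal.ofReal (q (c j)) := by
  have := isProbabilityMeasure_weightMeasure hq hqsum
  rw [bernoulliMeasure, infinitePi_initial_segment]
  simp only [weightMeasure_singleton]

theorem fiberMeasure_cylinder {I : Type*} {k : I → ℕ} {pm : (i : I) → Fin (k i) → ℝ}
    (hpm : ∀ i u, 0 ≤ pm i u) (hpmsum : ∀ i, ∑ u, pm i u = 1) (ω : ℕ → I)
    (N : ℕ) (c : (j : ℕ) → Fin (k (ω j))) :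
    fiberMeasure pm ω {u | ∀ j < N, u j = c j} =
      ∏ j ∈ Finset.range N, ENNReal.ofReal (pm (ω j) (c j)) := by
  have (i : I) := isProbabilityMeasure_weightMeasure (hpm i) (hpmsum i)
  rw [fiberMeasure, infinitePi_initial_segment]
  simp only [weightMeasure_singleton]

open Classical in
theorem map_pairSeq_fiberMeasure_cylinder (hpm : ∀ i u, 0 ≤ pm i u)
    (hpmsum : ∀ i, ∑ u, pm i u = 1) (ω : ℕ → I) (c : ℕ → Σ i, Fin (k i)) (N : ℕ) :
    (fiberMeasure pm ω).map (pairSeq ω) {w | ∀ j < N, w j = c j} =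
      ∏ j ∈ Finset.range N,
        if ω j = (c j).1 then ENNReal.ofReal (pm (c j).1 (c j).2) else 0 := by
  have (i : I) := isProbabilityMeasure_weightMeasure (hpm i) (hpmsum i)
  have hmeas : MeasurableSet {w : ℕ → Σ i, Fin (k i) | ∀ j < N, w j = c j} := by
    rw [pi_eq_generateFrom_cylinders]
    exact MeasurableSpace.measurableSet_generateFrom ⟨c, N, rfl⟩
  have hpre : pairSeq ω ⁻¹' {w : ℕ → Σ i, Fin (k i) | ∀ j < N, w j = c j} =
      (Finset.range N : Set ℕ).pi fun j => {x | (⟨ω j, x⟩ : Σ i, Fin (k i)) = c j} := by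
    ext u
    simp [pairSeq]
  have hsingle (i : I) (z : Σ i, Fin (k i)) :
      weightMeasure (pm i) {x | (⟨i, x⟩ : Σ i, Fin (k i)) = z} =
        if i = z.1 then ENNReal.ofReal (pm z.1 z.2) else 0 := by
    obtain ⟨i', y⟩ := z
    by_cases h : i = i'
    · subst h
      have : {x | (⟨i, x⟩ : Σ i, Fin (k i)) = ⟨i, y⟩} = {y} := by
        ext x
        simp
      rw [this, weightMeasure_singleton, if_pos rfl]
    · simp [h]
  rw [Measure.map_apply (measurable_pairSeq ω) hmeas, hpre, fiberMeasure,
    Measure.infinitePi_pi _ fun _ _ => MeasurableSet.of_discrete]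
  exact Finset.prod_congr rfl fun j _ => hsingle _ _

theorem measurable_map_pairSeq_fiberMeasure [MeasurableSpace I]
    [DiscreteMeasurableSpace I] (hpm : ∀ i u, 0 ≤ pm i u)
    (hpmsum : ∀ i, ∑ u, pm i u = 1) :
    Measurable fun ω : ℕ → I => (fiberMeasure pm ω).map (pairSeq ω) := by
  classical
  have (ω : ℕ → I) : IsProbabilityMeasure ((fiberMeasure pm ω).map (pairSeq ω)) :=
    have := isProbabilityMeasure_fiberMeasure hpm hpmsum ω
    Measure.isProbabilityMeasure_map (measurable_pairSeq ω).aemeasurable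
  refine Measurable.measure_of_isPiSystem_of_isProbabilityMeasure
    pi_eq_generateFrom_cylinders isPiSystem_cylinders ?_
  rintro _ ⟨c, N, rfl⟩
  simp only [map_pairSeq_fiberMeasure_cylinder hpm hpmsum]
  exact Finset.measurable_prod _ fun j _ => (Measurable.of_discrete (f := fun i : I =>
    if i = (c j).1 then ENNReal.ofReal (pm (c j).1 (c j).2) else 0)).comp (measurable_pi_apply j)

theorem bind_map_pairSeq_fiberMeasure [MeasurableSpace I]
    [DiscreteMeasurableSpace I] (hq : ∀ i, 0 ≤ q i) (hqsum : ∑ i, q i = 1)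
    (hpm : ∀ i u, 0 ≤ pm i u) (hpmsum : ∀ i, ∑ u, pm i u = 1) :
    (bernoulliMeasure q).bind (fun ω => (fiberMeasure pm ω).map (pairSeq ω)) =
      bernoulliMeasure fun x : Σ i, Fin (k i) => q x.1 * pm x.1 x.2 := by
  classical
  have hprob (ω : ℕ → I) : IsProbabilityMeasure ((fiberMeasure pm ω).map (pairSeq ω)) :=
    have := isProbabilityMeasure_fiberMeasure hpm hpmsum ω
    Measure.isProbabilityMeasure_map (measurable_pairSeq ω).aemeasurable
  have hP := isProbabilityMeasure_bernoulliMeasure hq hqsum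
  have hW (x : Σ i, Fin (k i)) : 0 ≤ q x.1 * pm x.1 x.2 := mul_nonneg (hq _) (hpm _ _)
  have hWsum : ∑ x : Σ i, Fin (k i), q x.1 * pm x.1 x.2 = 1 := by
    rw [Fintype.sum_sigma]
    simp only [← Finset.mul_sum, hpmsum, mul_one, hqsum]
  have := isProbabilityMeasure_bernoulliMeasure hW hWsum
  have hmeas := measurable_map_pairSeq_fiberMeasure hpm hpmsum
  have : IsProbabilityMeasure
      ((bernoulliMeasure q).bind fun ω => (fiberMeasure pm ω).map (pairSeq ω)) :=
    ⟨by rw [Measure.bind_apply MeasurableSet.univ hmeas.aemeasurable]; simp⟩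
  refine measure_ext_cylinders fun c N => ?_
  have hcyl : MeasurableSet {w : ℕ → Σ i, Fin (k i) | ∀ j < N, w j = c j} := by
    rw [pi_eq_generateFrom_cylinders]
    exact MeasurableSpace.measurableSet_generateFrom ⟨c, N, rfl⟩
  have hcyl' : MeasurableSet {ω : ℕ → I | ∀ j < N, ω j = (c j).1} := by
    rw [pi_eq_generateFrom_cylinders]
    exact MeasurableSpace.measurableSet_generateFrom ⟨fun j => (c j).1, N, rfl⟩
  rw [Measure.bind_apply hcyl hmeas.aemeasurable, bernoulliMeasure_cylinder hW hWsum]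
  simp only [map_pairSeq_fiberMeasure_cylinder hpm hpmsum, Finset.prod_ite_zero,
    Finset.mem_range]
  have hind : (fun ω : ℕ → I => if ∀ j < N, ω j = (c j).1 then
      ∏ j ∈ Finset.range N, ENNReal.ofReal (pm (c j).1 (c j).2) else 0) =
      {ω : ℕ → I | ∀ j < N, ω j = (c j).1}.indicator fun _ =>
        ∏ j ∈ Finset.range N, ENNReal.ofReal (pm (c j).1 (c j).2) := by
    ext ω
    simp only [Set.indicator_apply, Set.mem_ofPred_eq]
  rw [hind, lintegral_indicator_const hcyl',
    bernoulliMeasure_cylinder hq hqsum N fun j => (c j).1, ← Finset.prod_mul_distrib]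
  refine Finset.prod_congr rfl fun j _ => ?_
  rw [ENNReal.ofReal_mul (hq _), mul_comm]

/-- A stationary measure is the average of the fibre measures of a model refining its weights. -/
theorem SelfSimilar.eq_lintegral_map_coding [MeasurableSpace I]
    [DiscreteMeasurableSpace I] {r : I → ℝ} {t : (i : I) → Fin (k i) → ℝ} {c R : ℝ}
    (hc : c < 1) (hr : ∀ i, |r i| ≤ c) (hR : 0 ≤ R) (ht : ∀ i u, |t i u| ≤ R * (1 - |r i|))
    (hq : ∀ i, 0 ≤ q i) (hqsum : ∑ i, q i = 1)
    (hpm : ∀ i u, 0 ≤ pm i u) (hpmsum : ∀ i, ∑ u, pm i u = 1)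
    {μ : Measure ℝ} [IsProbabilityMeasure μ]
    (hμ : SelfSimilar (fun x : Σ i, Fin (k i) => q x.1 * pm x.1 x.2) (fun x => r x.1)
      (fun x => t x.1 x.2) μ) {E : Set ℝ} (hE : MeasurableSet E) :
    μ E = ∫⁻ ω, (fiberMeasure pm ω).map (coding k r t ω) E ∂bernoulliMeasure q := by
  have hW (x : Σ i, Fin (k i)) : 0 ≤ q x.1 * pm x.1 x.2 := mul_nonneg (hq _) (hpm _ _)
  have hWsum : ∑ x : Σ i, Fin (k i), q x.1 * pm x.1 x.2 = 1 := by
    rw [Fintype.sum_sigma]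
    simp only [← Finset.mul_sum, hpmsum, mul_one, hqsum]
  have hf := measurable_sigmaCoding hc hr hR ht
  have hself := selfSimilar_map_infinitePi hW hWsum hf (s := fun x => r x.1)
    (a := fun x => t x.1 x.2) fun x w => sigmaCoding_consSeq hc hr hR ht x w
  have := isProbabilityMeasure_bernoulliMeasure hW hWsum
  have : IsProbabilityMeasure ((bernoulliMeasure fun x : Σ i, Fin (k i) =>
    q x.1 * pm x.1 x.2).map (sigmaCoding k r t)) :=
    Measure.isProbabilityMeasure_map hf.aemeasurable
  have heq := hμ.unique (ν := (bernoulliMeasure fun x : Σ i, Fin (k i) =>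
    q x.1 * pm x.1 x.2).map (sigmaCoding k r t)) hW hWsum hc (fun x => hr x.1) hself
  rw [heq, Measure.map_apply hf hE, ← bind_map_pairSeq_fiberMeasure hq hqsum hpm hpmsum,
    Measure.bind_apply (hf hE) (measurable_map_pairSeq_fiberMeasure hpm hpmsum).aemeasurable]
  refine lintegral_congr fun ω => ?_
  rw [Measure.map_apply (measurable_pairSeq ω) (hf hE),
    Measure.map_apply (measurable_coding hc hr hR ht ω) hE]
  rfl

theorem ae_frequently_bernoulliMeasure [MeasurableSpace I] [DiscreteMeasurableSpace I]
    {q : I → ℝ} (hq : ∀ i, 0 ≤ q i) (hqsum : ∑ i, q i = 1)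
    {i : I} (hi : 0 < q i) : ∀ᵐ ω ∂bernoulliMeasure q, ∃ᶠ j in atTop, ω j = i := by
  have := isProbabilityMeasure_weightMeasure hq hqsum
  have := isProbabilityMeasure_bernoulliMeasure hq hqsum
  have hmeas (j : ℕ) : MeasurableSet {ω : ℕ → I | ω j = i} :=
    (measurable_pi_apply (X := fun _ : ℕ => I) j) (MeasurableSet.of_discrete (s := {i}))
  have hindep : ProbabilityTheory.iIndepSet (fun j => {ω : ℕ → I | ω j = i})
      (bernoulliMeasure q) := by
    rw [ProbabilityTheory.iIndepSet_iff_meas_biInter hmeas]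
    intro s
    have h (s : Finset ℕ) : bernoulliMeasure q (⋂ j ∈ s, {ω : ℕ → I | ω j = i}) =
        ∏ _j ∈ s, ENNReal.ofReal (q i) := by
      have := Measure.infinitePi_pi (fun _ : ℕ => weightMeasure q) (s := s) (t := fun _ => {i})
        fun _ _ => MeasurableSet.of_discrete
      rw [weightMeasure_singleton] at this
      rw [← this, bernoulliMeasure]
      congr 1
      ext ω
      simp
    rw [h]
    exact Finset.prod_congr rfl fun j _ => by simpa using (h {j}).symm
  have hval (j : ℕ) : bernoulliMeasure q {ω : ℕ → I | ω j = i} = ENNReal.ofReal (q i) := by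
    have := Measure.infinitePi_pi (fun _ : ℕ => weightMeasure q) (s := {j}) (t := fun _ => {i})
        fun _ _ => MeasurableSet.of_discrete
    simpa [bernoulliMeasure, weightMeasure_singleton, Set.preimage] using this
  have hlim := ProbabilityTheory.measure_limsup_eq_one hmeas hindep (by
    simp only [hval]
    exact ENNReal.tsum_const_eq_top_of_ne_zero (by simpa using hi))
  have hae := (prob_compl_eq_zero_iff (MeasurableSet.measurableSet_limsup hmeas)).2 hlim
  filter_upwards [compl_mem_ae_iff.2 hae] with ω hω
  rw [compl_compl, mem_limsup_iff_frequently_mem] at hω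
  exact hω

end Disintegration

theorem exists_prod_range_le_pow {f : ℕ → ENNReal} (hf : ∀ j, f j ≤ 1) {θ : ENNReal}
    (h : ∃ᶠ j in atTop, f j ≤ θ) (m : ℕ) : ∃ N, ∏ j ∈ Finset.range N, f j ≤ θ ^ m := by
  induction m with
  | zero => exact ⟨0, by simp⟩
  | succ m ih =>
    obtain ⟨N, hN⟩ := ih
    obtain ⟨j, hj, hjθ⟩ := frequently_atTop.1 h N
    refine ⟨j + 1, ?_⟩
    rw [Finset.prod_range_succ, pow_succ]
    refine mul_le_mul' (le_trans ?_ hN) hjθ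
    exact Finset.prod_le_prod_of_subset_of_le_one' (Finset.range_mono hj) fun i _ _ => hf i

theorem map_fiberMeasure_singleton_eq_zero {I : Type*} {k : I → ℕ} {pm : (i : I) → Fin (k i) → ℝ}
    (hpm : ∀ i u, 0 ≤ pm i u) (hpmsum : ∀ i, ∑ u, pm i u = 1) {ω : ℕ → I} {i : I} {θ : ℝ}
    (hθ : θ < 1) (hi : ∀ u, pm i u ≤ θ) (hω : ∃ᶠ j in atTop, ω j = i)
    {f : ((j : ℕ) → Fin (k (ω j))) → ℝ} (hf : Measurable f) (hinj : Function.Injective f)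
    (x : ℝ) : (fiberMeasure pm ω).map f {x} = 0 := by
  rw [Measure.map_apply hf (measurableSet_singleton x)]
  by_cases hx : ∃ u, f u = x
  · obtain ⟨u, rfl⟩ := hx
    have hle1 (i : I) (u : Fin (k i)) : pm i u ≤ 1 :=
      (hpmsum i) ▸ Finset.single_le_sum (fun v _ => hpm i v) (Finset.mem_univ u)
    have hfreq : ∃ᶠ j in atTop, ENNReal.ofReal (pm (ω j) (u j)) ≤ ENNReal.ofReal θ := by
      refine hω.mono fun j hj => ENNReal.ofReal_le_ofReal ?_
      have (i' : I) (hi' : i' = i) (v : Fin (k i')) : pm i' v ≤ θ := by subst hi'; exact hi v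
      exact this _ hj _
    have hlim : Tendsto (fun m : ℕ => ENNReal.ofReal θ ^ m) atTop (𝓝 0) :=
      ENNReal.tendsto_pow_atTop_nhds_zero_of_lt_one (by simpa using hθ)
    refine le_antisymm (ge_of_tendsto' hlim fun m => ?_) zero_le
    obtain ⟨N, hN⟩ := exists_prod_range_le_pow
      (fun j => ENNReal.ofReal_le_one.2 (hle1 (ω j) (u j))) hfreq m
    refine le_trans (measure_mono ?_) ((fiberMeasure_cylinder hpm hpmsum ω N u).trans_le hN)
    intro v hv j _
    rw [hinj hv]
  · have : f ⁻¹' {x} = ∅ := by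
      ext u
      simp only [Set.mem_preimage, Set.mem_singleton_iff, Set.mem_empty_iff_false, iff_false]
      exact fun h => hx ⟨u, h⟩
    rw [this, measure_empty]

/-- A stationary contractive affine system with positive weights whose maps preserve `[-R, R]`. -/
structure IsContractiveSystem {ι : Type*} [Fintype ι] (c R : ℝ) (p s a : ι → ℝ)
    (μ : Measure ℝ) : Prop where
  pos : ∀ i, 0 < p i
  sum_eq_one : ∑ i, p i = 1
  ne_zero : ∀ i, s i ≠ 0
  abs_le : ∀ i, |s i| ≤ c
  abs_translation_le : ∀ i, |a i| ≤ R * (1 - |s i|)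
  selfSimilar : SelfSimilar p s a μ

namespace IsContractiveSystem

theorem prod {ι κ : Type*} [Fintype ι] [Fintype κ] {c R : ℝ} (hc : c < 1)
    {p s a : ι → ℝ} {p' s' a' : κ → ℝ} {μ : Measure ℝ} (h : IsContractiveSystem c R p s a μ)
    (h' : IsContractiveSystem c R p' s' a' μ) :
    IsContractiveSystem c R (fun x : ι × κ => p x.1 * p' x.2) (fun x => s x.1 * s' x.2)
      (fun x => s x.1 * a' x.2 + a x.1) μ where
  pos x := mul_pos (h.pos _) (h'.pos _)
  sum_eq_one := by
    rw [Fintype.sum_prod_type]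
    simp only [← Finset.mul_sum, h'.sum_eq_one, mul_one, h.sum_eq_one]
  ne_zero x := mul_ne_zero (h.ne_zero _) (h'.ne_zero _)
  abs_le x := by
    rw [abs_mul]
    exact (mul_le_of_le_one_right (abs_nonneg _) ((h'.abs_le _).trans hc.le)).trans (h.abs_le _)
  abs_translation_le x := by
    have h1 := abs_add_le (s x.1 * a' x.2) (a x.1)
    have h2 := mul_le_mul_of_nonneg_left (h'.abs_translation_le x.2) (abs_nonneg (s x.1))
    have h3 := h.abs_translation_le x.1
    rw [abs_mul] at h1 ⊢
    linarith
  selfSimilar := h.selfSimilar.prod (fun i => (h.pos i).le) h'.selfSimilar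

/-- Iterating a system `2 ^ m` times gives a system containing the `2 ^ m`-fold iterates of the
original maps. -/
theorem exists_iterate {ι : Type} [Fintype ι] {c R : ℝ} (hc : c < 1) {p s a : ι → ℝ}
    {μ : Measure ℝ} (h : IsContractiveSystem c R p s a μ) (m : ℕ) :
    ∃ (κ : Type) (_ : Fintype κ) (p' s' a' : κ → ℝ) (d : ι → κ),
      IsContractiveSystem c R p' s' a' μ ∧ (∀ i, s' (d i) = s i ^ 2 ^ m) ∧
        ∀ i x, s i * x + a i = x → s' (d i) * x + a' (d i) = x := by
  induction m with
  | zero => exact ⟨ι, inferInstance, p, s, a, id, h, by simp, fun _ _ hx => hx⟩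
  | succ m ih =>
    obtain ⟨κ, _, p', s', a', d, hsys, hpow, hfix⟩ := ih
    refine ⟨κ × κ, inferInstance, _, _, _, fun i => (d i, d i), hsys.prod hc hsys, fun i => ?_,
      fun i x hx => ?_⟩
    · simp only [hpow]
      ring
    · have := hfix i x hx
      calc s' (d i) * s' (d i) * x + (s' (d i) * a' (d i) + a' (d i))
          = s' (d i) * (s' (d i) * x + a' (d i)) + a' (d i) := by ring
        _ = x := by rw [this, this]

theorem abs_apply_le {ι : Type*} [Fintype ι] {c R : ℝ} {p s a : ι → ℝ} {μ : Measure ℝ}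
    (h : IsContractiveSystem c R p s a μ) (i : ι) {x : ℝ} (hx : |x| ≤ R) :
    |s i * x + a i| ≤ R := by
  have h1 := abs_add_le (s i * x) (a i)
  have h2 := mul_le_mul_of_nonneg_left hx (abs_nonneg (s i))
  have h3 := h.abs_translation_le i
  rw [abs_mul] at h1
  linarith

theorem abs_le_of_fixedPoint {ι : Type*} [Fintype ι] {c R : ℝ} (hc : c < 1) {p s a : ι → ℝ}
    {μ : Measure ℝ} (h : IsContractiveSystem c R p s a μ) {i : ι} {x : ℝ}
    (hx : s i * x + a i = x) : |x| ≤ R := by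
  have h1 := abs_add_le (s i * x) (a i)
  have h3 := h.abs_translation_le i
  rw [abs_mul, hx] at h1
  have h4 : 0 < 1 - |s i| := by linarith [h.abs_le i]
  have : |x| * (1 - |s i|) ≤ R * (1 - |s i|) := by linarith
  exact le_of_mul_le_mul_right this h4

theorem exists_distinct_fixedPoints {ι : Type*} [Fintype ι] {c R : ℝ} (hc : c < 1)
    {p s a : ι → ℝ} {μ : Measure ℝ} [IsProbabilityMeasure μ] (hna : ∀ x, μ {x} = 0)
    (h : IsContractiveSystem c R p s a μ) :
    ∃ i j x y, s i * x + a i = x ∧ s j * y + a j = y ∧ x ≠ y := by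
  have hfix (i : ι) : s i * (a i / (1 - s i)) + a i = a i / (1 - s i) := by
    have : 1 - s i ≠ 0 := by linarith [le_abs_self (s i), h.abs_le i]
    field_simp
    ring
  have hne : Nonempty ι := by
    by_contra hne
    rw [not_nonempty_iff] at hne
    simpa using h.sum_eq_one
  by_contra! hcon
  have hdirac := h.selfSimilar.eq_dirac_of_fixedPoint (fun i => (h.pos i).le) h.sum_eq_one hc
    h.abs_le (x := a hne.some / (1 - s hne.some)) fun i => by
      rw [← hcon i hne.some _ _ (hfix i) (hfix _)]
      exact hfix i
  have := hna (a hne.some / (1 - s hne.some))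
  rw [hdirac] at this
  simp at this

/-- Some iterate of a system with a non-atomic stationary measure contains two distinct maps of
the same ratio with disjoint images of `[-R, R]`. -/
theorem exists_separated_pair {ι : Type} [Fintype ι] {c R : ℝ} (hc : c < 1)
    {p s a : ι → ℝ} {μ : Measure ℝ} [IsProbabilityMeasure μ] (hna : ∀ x, μ {x} = 0)
    (h : IsContractiveSystem c R p s a μ) :
    ∃ (κ : Type) (_ : Fintype κ) (p' s' a' : κ → ℝ) (A B : κ),
      IsContractiveSystem c R p' s' a' μ ∧ A ≠ B ∧ s' A = s' B ∧
      (∀ x y, |x| ≤ R → |y| ≤ R → s' A * x + a' A ≠ s' B * y + a' B) ∧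
      ∃ N : ℕ, N ≠ 0 ∧ ∀ i, ∃ l, s' l = s i ^ N := by
  obtain ⟨i, j, x, y, hx, hy, hxy⟩ := h.exists_distinct_fixedPoints hc hna
  have hc0 : 0 ≤ c := (abs_nonneg _).trans (h.abs_le i)
  have hlim : Tendsto (fun m : ℕ => c ^ 2 ^ m * (4 * R)) atTop (𝓝 (0 * (4 * R))) :=
    ((tendsto_pow_atTop_nhds_zero_of_lt_one hc0 hc).comp
      (tendsto_pow_atTop_atTop_of_one_lt one_lt_two)).mul_const _
  rw [zero_mul] at hlim
  obtain ⟨m, hm⟩ := (hlim.eventually (gt_mem_nhds (abs_pos.2 (sub_ne_zero.2 hxy)))).exists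
  obtain ⟨κ, _, p', s', a', d, hsys, hpow, hfix⟩ := h.exists_iterate hc m
  have hnear (i : ι) (x z : ℝ) (hx : s i * x + a i = x) (hz : |z| ≤ R) :
      |s' (d i) * z + a' (d i) - x| ≤ c ^ 2 ^ m * (2 * R) := by
    have hxR := h.abs_le_of_fixedPoint hc hx
    have heq : s' (d i) * z + a' (d i) - x = s i ^ 2 ^ m * (z - x) := by
      rw [← hpow]
      linear_combination hfix i x hx
    rw [heq, abs_mul, abs_pow]
    gcongr
    · exact h.abs_le i
    · linarith [abs_sub z x]
  have hdisj (z w : ℝ) (hz : |z| ≤ R) (hw : |w| ≤ R) :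
      s' (d i) * z + a' (d i) ≠ s' (d j) * w + a' (d j) := by
    intro heq
    have h1 := hnear i x z hx hz
    have h2 := hnear j y w hy hw
    rw [heq] at h1
    have h3 := abs_sub_le x (s' (d j) * w + a' (d j)) y
    rw [abs_sub_comm] at h1
    linarith
  have hxR := h.abs_le_of_fixedPoint hc hx
  have hdij : d i ≠ d j := fun heq => hdisj x x hxR hxR (by rw [heq])
  refine ⟨κ × κ, inferInstance, _, _, _, (d i, d j), (d j, d i), hsys.prod hc hsys,
    fun heq => hdij (congrArg Prod.fst heq), mul_comm _ _, fun z w hz hw heq => ?_,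
    2 ^ m * 2, by positivity, fun l => ⟨(d l, d l), ?_⟩⟩
  · refine hdisj _ _ (hsys.abs_apply_le (d j) hz) (hsys.abs_apply_le (d i) hw) ?_
    linear_combination heq
  · simp only [hpow]
    ring

end IsContractiveSystem

/-- A finite type with two distinguished elements is partitioned into that pair and singletons. -/
theorem exists_sigma_equiv_of_pair {Λ : Type*} [Fintype Λ] {A B : Λ} (hAB : A ≠ B) :
    ∃ (m : ℕ) (k : Fin m → ℕ) (w : (Σ i, Fin (k i)) ≃ Λ), (∀ i, 0 < k i) ∧ (∃ i, 1 < k i) ∧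
      ∀ i u v, u ≠ v → (w ⟨i, u⟩ = A ∧ w ⟨i, v⟩ = B) ∨ (w ⟨i, u⟩ = B ∧ w ⟨i, v⟩ = A) := by
  classical
  let e : Fin (Fintype.card {x // x ≠ B}) ≃ {x // x ≠ B} := (Fintype.equivFin _).symm
  let k : Fin (Fintype.card {x // x ≠ B}) → ℕ := fun i => if (e i : Λ) = A then 2 else 1
  let w : (Σ i, Fin (k i)) → Λ := fun x => if (x.2 : ℕ) = 0 then e x.1 else B
  have hlt (i) (u : Fin (k i)) (hu : (u : ℕ) ≠ 0) : (e i : Λ) = A ∧ (u : ℕ) = 1 := by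
    have h := u.2
    by_cases hi : (e i : Λ) = A
    · simp only [k, hi, if_true] at h
      exact ⟨hi, by omega⟩
    · simp only [k, hi, if_false] at h
      omega
  have hk (i) : 0 < k i := by
    simp only [k]
    split_ifs <;> norm_num
  have hkA : 1 < k (e.symm ⟨A, hAB⟩) := by simp [k]
  have hw : Function.Bijective w := by
    constructor
    · rintro ⟨i, u⟩ ⟨j, v⟩ h
      have hij : i = j ∧ (u : ℕ) = v := by
        by_cases hu : (u : ℕ) = 0 <;> by_cases hv : (v : ℕ) = 0
        · simp only [w, hu, hv, if_true] at h
          exact ⟨e.injective (Subtype.ext h), hu.trans hv.symm⟩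
        · simp only [w, hu, hv, if_true, if_false] at h
          exact absurd h (e i).2
        · simp only [w, hu, hv, if_true, if_false] at h
          exact absurd h.symm (e j).2
        · have h1 := hlt i u hu
          have h2 := hlt j v hv
          exact ⟨e.injective (Subtype.ext (h1.1.trans h2.1.symm)), h1.2.trans h2.2.symm⟩
      obtain ⟨rfl, huv⟩ := hij
      rw [Fin.ext huv]
    · intro x
      by_cases hx : x = B
      · exact ⟨⟨e.symm ⟨A, hAB⟩, ⟨1, hkA⟩⟩, by simp [w, hx]⟩
      · exact ⟨⟨e.symm ⟨x, hx⟩, ⟨0, hk _⟩⟩, by simp [w]⟩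
  refine ⟨_, k, Equiv.ofBijective w hw, hk, ⟨_, hkA⟩, fun i u v huv => ?_⟩
  simp only [Equiv.ofBijective_apply, w]
  by_cases hu : (u : ℕ) = 0 <;> by_cases hv : (v : ℕ) = 0
  · exact absurd (Fin.ext (hu.trans hv.symm)) huv
  · simp [hu, hlt i v hv]
  · simp [hv, hlt i u hu]
  · exact absurd (Fin.ext ((hlt i u hu).2.trans (hlt i v hv).2.symm)) huv

theorem exists_lt_one_forall_le_of_sum_eq_one {α : Type*} [Fintype α] [Nontrivial α] {p : α → ℝ}
    (hp : ∀ i, 0 < p i) (hsum : ∑ i, p i = 1) : ∃ θ < 1, ∀ i, p i ≤ θ := by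
  classical
  obtain ⟨x, hx⟩ := Finite.exists_max p
  refine ⟨p x, ?_, hx⟩
  obtain ⟨y, hy⟩ := exists_ne x
  have := Finset.add_le_sum (fun i _ => (hp i).le) (Finset.mem_univ x) (Finset.mem_univ y) hy.symm
  linarith [hp y]

/-- every non-atomic self-similar measure `μ` admits a disintegration over a
non-trivial Bernoulli model with strong separation: (a) the selection measure `ℙ` is the
Bernoulli measure `q^ℕ` and the measures `η̄^{(ω)}` are the product measures `Π_n p_{ω_n}`
(both characterized by their cylinder values); (b) strong separation holds; (c) `η^{(ω)}`
is non-atomic `ℙ`-a.s.; (d) `μ = ∫ η^{(ω)} dℙ(ω)`; (e) if `log|s_j|/log β` is irrational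
for some `j`, then `log|r_i|/log β` is irrational for some `i ∈ I`. -/
theorem stmt4
    (n : ℕ) (s a : Fin n → ℝ)
    (hs : ∀ i, |s i| < 1) (hs0 : ∀ i, s i ≠ 0)
    (p : Fin n → ℝ) (hp : ∀ i, 0 < p i) (hpsum : ∑ i, p i = 1)
    (μ : Measure ℝ) (hprob : IsProbabilityMeasure μ)
    (hself : μ = ∑ i, ENNReal.ofReal (p i) • Measure.map (fun x => s i * x + a i) μ)
    (hna : ∀ x : ℝ, μ {x} = 0)
    (β : ℝ) (hβ : 1 < β) :
    ∃ (mI : ℕ) (k : Fin mI → ℕ) (r : Fin mI → ℝ) (t : (i : Fin mI) → Fin (k i) → ℝ)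
      (pm : (i : Fin mI) → Fin (k i) → ℝ) (q : Fin mI → ℝ)
      (P : Measure (ℕ → Fin mI))
      (η' : (ω : ℕ → Fin mI) → Measure ((j : ℕ) → Fin (k (ω j)))),
      (∀ i, 0 < k i) ∧
      (∀ i, |r i| < 1 ∧ r i ≠ 0) ∧
      (∀ i j, 0 < pm i j) ∧ (∀ i, ∑ j, pm i j = 1) ∧
      (∀ i, 0 < q i) ∧ (∑ i, q i = 1) ∧
      -- (a) ℙ is the Bernoulli measure q^ℕ
      IsProbabilityMeasure P ∧
      (∀ (N : ℕ) (c : ℕ → Fin mI),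
        P {ω | ∀ j < N, ω j = c j} = ∏ j ∈ Finset.range N, ENNReal.ofReal (q (c j))) ∧
      -- the η̄^{(ω)} are the product measures Π_n p_{ω_n}
      (∀ ω, IsProbabilityMeasure (η' ω)) ∧
      (∀ (ω : ℕ → Fin mI) (N : ℕ) (c : (j : ℕ) → Fin (k (ω j))),
        η' ω {u | ∀ j < N, u j = c j} = ∏ j ∈ Finset.range N, ENNReal.ofReal (pm (ω j) (c j))) ∧
      -- (b) strong separation
      (∀ ω : ℕ → Fin mI, ∀ u v : Fin (k (ω 0)), u ≠ v →
        Disjoint ((fun x => r (ω 0) * x + t (ω 0) u) '' Yset k r t (shiftSeq ω))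
                 ((fun x => r (ω 0) * x + t (ω 0) v) '' Yset k r t (shiftSeq ω))) ∧
      -- (c) non-triviality: η^{(ω)} is ℙ-a.s. non-atomic
      (∀ᵐ ω ∂P, ∀ x : ℝ, Measure.map (coding k r t ω) (η' ω) {x} = 0) ∧
      -- (d) μ = ∫ η^{(ω)} dℙ(ω)
      (∀ E : Set ℝ, MeasurableSet E →
        μ E = ∫⁻ ω, Measure.map (coding k r t ω) (η' ω) E ∂P) ∧
      -- (e) the arithmetic condition is preserved
      ((∃ j, Irrational (Real.log |s j| / Real.log β)) →
        ∃ i, Irrational (Real.log |r i| / Real.log β)) := by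
  have hne : Nonempty (Fin n) := by
    by_contra hne
    rw [not_nonempty_iff] at hne
    simp at hpsum
  obtain ⟨i₀, hi₀⟩ := Finite.exists_max fun i => |s i|
  set c := |s i₀|
  have hc : c < 1 := hs i₀
  have hc' : 0 < 1 - c := sub_pos.2 hc
  set R := (∑ i, |a i|) / (1 - c)
  have hR : 0 ≤ R := div_nonneg (Finset.sum_nonneg fun _ _ => abs_nonneg _) hc'.le
  have hsys : IsContractiveSystem c R p s a μ :=
    { pos := hp
      sum_eq_one := hpsum
      ne_zero := hs0
      abs_le := hi₀
      abs_translation_le := fun i =>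
        calc |a i| ≤ ∑ i, |a i| :=
              Finset.single_le_sum (f := fun i => |a i|) (fun _ _ => abs_nonneg _)
                (Finset.mem_univ i)
          _ = R * (1 - c) := (div_mul_cancel₀ _ hc'.ne').symm
          _ ≤ R * (1 - |s i|) := by
            gcongr
            exact hi₀ i
      selfSimilar := hself }
  obtain ⟨κ, _, p', s', a', A, B, hsys', hAB, hsAB, hdisj, N, hN, hpow⟩ :=
    hsys.exists_separated_pair hc hna
  obtain ⟨m, k, w, hk, ⟨i₁, hi₁⟩, hpair⟩ := exists_sigma_equiv_of_pair hAB
  let r : Fin m → ℝ := fun i => s' (w ⟨i, ⟨0, hk i⟩⟩)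
  let t : (i : Fin m) → Fin (k i) → ℝ := fun i u => a' (w ⟨i, u⟩)
  let q : Fin m → ℝ := fun i => ∑ u, p' (w ⟨i, u⟩)
  let pm : (i : Fin m) → Fin (k i) → ℝ := fun i u => p' (w ⟨i, u⟩) / q i
  have hratio (i) (u : Fin (k i)) : s' (w ⟨i, u⟩) = r i := by
    by_cases hu : u = ⟨0, hk i⟩
    · rw [hu]
    · rcases hpair i u ⟨0, hk i⟩ hu with h | h
      · rw [h.1, hsAB, ← h.2]
      · rw [h.1, ← hsAB, ← h.2]
  have hr (i) : |r i| ≤ c := hsys'.abs_le _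
  have hr0 (i) : r i ≠ 0 := hsys'.ne_zero _
  have ht (i) (u : Fin (k i)) : |t i u| ≤ R * (1 - |r i|) := by
    rw [← hratio i u]
    exact hsys'.abs_translation_le _
  have hsep (i) (u v : Fin (k i)) (huv : u ≠ v) (x y : ℝ) (hx : |x| ≤ R) (hy : |y| ≤ R) :
      r i * x + t i u ≠ r i * y + t i v := by
    conv_lhs => rw [← hratio i u]
    conv_rhs => rw [← hratio i v]
    simp only [t]
    rcases hpair i u v huv with h | h
    · rw [h.1, h.2]
      exact hdisj x y hx hy
    · rw [h.1, h.2]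
      exact (hdisj y x hy hx).symm
  have hq (i) : 0 < q i :=
    Finset.sum_pos (fun _ _ => hsys'.pos _) ⟨⟨0, hk i⟩, Finset.mem_univ _⟩
  have hqsum : ∑ i, q i = 1 := by
    rw [← hsys'.sum_eq_one, ← w.sum_comp, Fintype.sum_sigma]
  have hpm (i) (u : Fin (k i)) : 0 < pm i u := div_pos (hsys'.pos _) (hq i)
  have hpmsum (i) : ∑ u, pm i u = 1 := by
    simp only [pm, ← Finset.sum_div]
    exact div_self (hq i).ne'
  have hself' : SelfSimilar (fun x : Σ i, Fin (k i) => q x.1 * pm x.1 x.2) (fun x => r x.1)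
      (fun x => t x.1 x.2) μ := by
    convert hsys'.selfSimilar.reindex w using 1
    · ext x
      exact mul_div_cancel₀ _ (hq x.1).ne'
    · ext x
      exact (hratio x.1 x.2).symm
    · rfl
  refine ⟨m, k, r, t, pm, q, bernoulliMeasure q, fiberMeasure pm, hk,
    fun i => ⟨(hr i).trans_lt hc, hr0 i⟩, hpm, hpmsum, hq, hqsum,
    isProbabilityMeasure_bernoulliMeasure (fun i => (hq i).le) hqsum,
    bernoulliMeasure_cylinder (fun i => (hq i).le) hqsum,
    isProbabilityMeasure_fiberMeasure (fun i u => (hpm i u).le) hpmsum,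
    fiberMeasure_cylinder (fun i u => (hpm i u).le) hpmsum,
    fun ω u v huv => disjoint_image_Yset hc hr hR ht hsep (shiftSeq ω) (ω 0) huv, ?_,
    fun E hE => hself'.eq_lintegral_map_coding hc hr hR ht (fun i => (hq i).le) hqsum
      (fun i u => (hpm i u).le) hpmsum hE, ?_⟩
  · have : Nontrivial (Fin (k i₁)) := Fin.nontrivial_iff_two_le.2 hi₁
    obtain ⟨θ, hθ, hle⟩ := exists_lt_one_forall_le_of_sum_eq_one (hpm i₁) (hpmsum i₁)
    filter_upwards [ae_frequently_bernoulliMeasure (fun i => (hq i).le) hqsum (hq i₁)] with ω hω x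
    exact map_fiberMeasure_singleton_eq_zero (fun i u => (hpm i u).le) hpmsum hθ hle hω
      (measurable_coding hc hr hR ht ω) (coding_injective hc hr hR ht hr0 hsep ω) x
  · rintro ⟨j, hj⟩
    obtain ⟨l, hl⟩ := hpow j
    refine ⟨(w.symm l).1, ?_⟩
    have hrl : r (w.symm l).1 = s j ^ N := by
      rw [← hratio _ (w.symm l).2, Sigma.eta, w.apply_symm_apply, hl]
    rw [hrl, abs_pow, Real.log_pow, mul_div_assoc]
    exact hj.natCast_mul hN
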